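/- Let (R, m) be a 2-dimensional Cohen-Macaulay local ring with infinite residue field, I, J m-primary ideals, (x, y; z, w) a complete reduction of (I, J), and fix r, s ≥ 0. Then for all sufficiently large k, the multiplication-by-xzyw map from I^{2k+r}J^{2k+s}/((xz)^k,(yw)^k)I^{k+r}J^{k+s} to I^{2k+r+2}J^{2k+s+2}/((xz)^{k+1},(yw)^{k+1})I^{k+r+1}J^{k+s+1} is an isomorphism. -/

import Mathlib

open IsLocalRing

section Helpers

variable {R : Type*} [CommRing R]

theorem mem_span_pair_mul {p q d : R} {A : Ideal R} :
    d ∈ Ideal.span {p, q} * A ↔ ∃ u ∈ A, ∃ v ∈ A, d = p * u + q * v := by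
  rw [Ideal.span_insert, Ideal.sup_mul, Submodule.mem_sup]
  constructor
  · rintro ⟨f, hf, g, hg, rfl⟩
    obtain ⟨u, hu, rfl⟩ := Ideal.mem_span_singleton_mul.1 hf
    obtain ⟨v, hv, rfl⟩ := Ideal.mem_span_singleton_mul.1 hg
    exact ⟨u, hu, v, hv, rfl⟩
  · rintro ⟨u, hu, v, hv, rfl⟩
    exact ⟨_, Ideal.mem_span_singleton_mul.2 ⟨u, hu, rfl⟩, _,
      Ideal.mem_span_singleton_mul.2 ⟨v, hv, rfl⟩, rfl⟩

theorem regular_pair_elem {α β : R} (h : RingTheory.Sequence.IsRegular R [α, β]) :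
    (∀ t, α * t = 0 → t = 0) ∧ (∀ t s, β * t = α * s → ∃ t', t = α * t') := by
  have h := h.toIsWeaklyRegular
  rw [RingTheory.Sequence.isWeaklyRegular_cons_iff,
    RingTheory.Sequence.isWeaklyRegular_singleton_iff] at h
  obtain ⟨h1, h2⟩ := h
  refine ⟨fun t ht => h1 (by simpa using ht), fun t s hts => ?_⟩
  have key : (Submodule.Quotient.mk t : QuotSMulTop α R) = 0 := by
    apply h2
    change β • (Submodule.Quotient.mk t : QuotSMulTop α R) = β • 0
    rw [smul_zero, ← Submodule.Quotient.mk_smul, Submodule.Quotient.mk_eq_zero,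
      Submodule.mem_smul_pointwise_iff_exists]
    exact ⟨s, trivial, by simp [hts]⟩
  rw [Submodule.Quotient.mk_eq_zero, Submodule.mem_smul_pointwise_iff_exists] at key
  obtain ⟨t', -, h⟩ := key
  exact ⟨t', by simpa using h.symm⟩

theorem pow_regular {α : R} (h1 : ∀ t, α * t = 0 → t = 0) (p : ℕ) :
    ∀ t, α ^ p * t = 0 → t = 0 := by
  induction p with
  | zero => intro t ht; simpa using ht
  | succ p ih => intro t ht; exact h1 _ (ih _ (by rw [← ht]; ring))

theorem pow_quot_regular {α β : R} (h1 : ∀ t, α * t = 0 → t = 0)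
    (h2 : ∀ t s, β * t = α * s → ∃ t', t = α * t') (p q : ℕ) :
    ∀ t s, β ^ q * t = α ^ p * s → ∃ t', t = α ^ p * t' := by
  have step : ∀ p : ℕ, ∀ t s, β * t = α ^ p * s → ∃ t', t = α ^ p * t' := by
    intro p
    induction p with
    | zero => intro t s _; exact ⟨t, by simp⟩
    | succ p ih =>
      intro t s h
      obtain ⟨t1, rfl⟩ := h2 t (α ^ p * s) (by rw [h]; ring)
      obtain ⟨t2, rfl⟩ := ih t1 s (sub_eq_zero.1 (h1 _ (by linear_combination h)))
      exact ⟨t2, by ring⟩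
  induction q with
  | zero => intro t s h; exact ⟨s, by simpa using h⟩
  | succ q ih =>
    intro t s h
    obtain ⟨t1, h3⟩ := ih (β * t) s (by rw [← h]; ring)
    exact step p t t1 h3

theorem koszul_of_regular {a b α β : R} (h1 : ∀ t, α * t = 0 → t = 0)
    (h2 : ∀ t s, β * t = α * s → ∃ t', t = α * t')
    (hα : α ∈ Ideal.span {a, b}) (hβ : β ∈ Ideal.span {a, b}) :
    ∀ u v, a * u + b * v = 0 → ∃ t, u = t * b ∧ v = -(t * a) := by
  intro u v h
  obtain ⟨p, q, rfl⟩ := Ideal.mem_span_pair.1 hα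
  obtain ⟨p', q', rfl⟩ := Ideal.mem_span_pair.1 hβ
  obtain ⟨t, ht⟩ := h2 (q * u - p * v) (q' * u - p' * v) (by
    linear_combination (p' * q - p * q') * h)
  refine ⟨t, sub_eq_zero.1 (h1 _ ?_), sub_eq_zero.1 (h1 _ ?_)⟩
  · linear_combination p * h + b * ht
  · linear_combination q * h - a * ht

theorem nzd_of_koszul [IsNoetherianRing R] [IsLocalRing R] {a b : R}
    (h : ∀ u v, a * u + b * v = 0 → ∃ t, u = t * b ∧ v = -(t * a))
    (hb : b ∈ maximalIdeal R) : ∀ t, a * t = 0 → t = 0 := by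
  have key : ∀ n : ℕ, ∀ t, a * t = 0 → t ∈ maximalIdeal R ^ n := by
    intro n
    induction n with
    | zero => intro t _; simp
    | succ n ih =>
      intro t ht
      obtain ⟨t', rfl, h'⟩ := h t 0 (by simpa using ht)
      rw [pow_succ]
      exact Ideal.mul_mem_mul (ih t' (by linear_combination h')) hb
  intro t ht
  have : t ∈ ⨅ i : ℕ, maximalIdeal R ^ i := by
    rw [Submodule.mem_iInf]; exact fun n => key n t ht
  rw [Ideal.iInf_pow_eq_bot_of_isLocalRing _ (Ideal.IsPrime.ne_top inferInstance)] at this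
  simpa using this

theorem div_of_koszul {a b : R}
    (h : ∀ u v, a * u + b * v = 0 → ∃ t, u = t * b ∧ v = -(t * a)) (k : ℕ) :
    ∀ u s, a ^ k * u = b * s → ∃ u', u = b * u' := by
  induction k with
  | zero => intro u s e; exact ⟨s, by simpa using e⟩
  | succ k ih =>
    intro u s e
    obtain ⟨t, e1⟩ := ih (a * u) s (by rw [← e]; ring)
    obtain ⟨t', e2, -⟩ := h u (-t) (by linear_combination e1)
    exact ⟨t', by rw [e2]; ring⟩

theorem pow_mul_memG {c : R} {L C : Ideal R} (hc : c ∈ L) (j n : ℕ) (f : R)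
    (hf : f ∈ L ^ n * C) : c ^ j * f ∈ L ^ (n + j) * C := by
  have := Ideal.mul_mem_mul (Ideal.pow_mem_pow hc j) hf
  rwa [← mul_assoc, ← pow_add, add_comm j n] at this

theorem mul_memG {c : R} {L C : Ideal R} (hc : c ∈ L) (n : ℕ) (f : R)
    (hf : f ∈ L ^ n * C) : c * f ∈ L ^ (n + 1) * C := by
  simpa using pow_mul_memG hc 1 n f hf

theorem ratliff_rush [IsNoetherianRing R] {a b : R} {L C : Ideal R} (ha : a ∈ L) (hb : b ∈ L)
    {N : ℕ} (hN : ∀ n ≥ N, Ideal.span {a, b} * L ^ n = L ^ (n + 1))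
    (hna : ∀ t, a * t = 0 → t = 0) :
    ∃ K : ℕ, ∀ n ≥ K, ∀ h : R, a * h ∈ L ^ (n + 1) * C → b * h ∈ L ^ (n + 1) * C →
      h ∈ L ^ n * C := by
  obtain ⟨c, hc⟩ := Ideal.exists_pow_inf_eq_pow_smul (M := R) L (Ideal.span {a})
  have hAR : ∀ n ≥ c, ∀ h, a * h ∈ L ^ (n + 1) → h ∈ L ^ (n - c) := by
    intro n hn h hh
    have h3 : a * h ∈ L ^ n • (⊤ : Submodule R R) ⊓ Ideal.span {a} := by
      refine ⟨?_, Ideal.mem_span_singleton.2 ⟨h, rfl⟩⟩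
      rw [smul_eq_mul, Ideal.mul_top]
      exact Ideal.pow_le_pow_right (Nat.le_succ n) hh
    rw [hc n hn] at h3
    have h4 : a * h ∈ L ^ (n - c) * Ideal.span {a} :=
      Ideal.mul_mono_right inf_le_right h3
    rw [mul_comm] at h4
    obtain ⟨g, hg, e⟩ := Ideal.mem_span_singleton_mul.1 h4
    have : h = g := sub_eq_zero.1 (hna _ (by linear_combination -e))
    exact this ▸ hg
  have hqL : Ideal.span {a, b} ≤ L := by
    rw [Ideal.span_le]
    rintro t (rfl | rfl)
    exacts [ha, hb]
  have hstep : ∀ i, Ideal.span {a, b} * L ^ (i - c) ≤ L ^ (i + 1 - c) := by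
    intro i
    by_cases hi : c ≤ i
    · rw [Nat.sub_add_comm hi, pow_succ']
      exact Ideal.mul_mono_left hqL
    · rw [Nat.sub_eq_zero_of_le (by omega : i + 1 ≤ c)]
      simp
  let F' : (Ideal.span {a, b} : Ideal R).Filtration R :=
    { N := fun n => L ^ (n - c)
      mono := fun i => Ideal.pow_le_pow_right (by omega)
      smul_le := hstep }
  have hF' : F'.Stable := by
    refine ⟨N + c, fun n hn => ?_⟩
    change Ideal.span {a, b} * L ^ (n - c) = L ^ (n + 1 - c)
    rw [hN (n - c) (by omega), Nat.sub_add_comm (by omega)]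
  let Q : ℕ → Ideal R := fun n =>
    { carrier := {h | a * h ∈ L ^ (n + 1) * C ∧ b * h ∈ L ^ (n + 1) * C ∧ h ∈ L ^ (n - c)}
      zero_mem' := by simp
      add_mem' := by
        rintro s t ⟨h1, h2, h3⟩ ⟨h4, h5, h6⟩
        refine ⟨?_, ?_, add_mem h3 h6⟩
        · rw [mul_add]; exact add_mem h1 h4
        · rw [mul_add]; exact add_mem h2 h5
      smul_mem' := by
        rintro s t ⟨h1, h2, h3⟩
        refine ⟨?_, ?_, Ideal.mul_mem_left _ _ h3⟩
        · rw [smul_eq_mul, mul_left_comm]; exact Ideal.mul_mem_left _ _ h1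
        · rw [smul_eq_mul, mul_left_comm]; exact Ideal.mul_mem_left _ _ h2 }
  have hQ1 : ∀ i, Ideal.span {a, b} * Q i ≤ L ^ (i + 1) * C := by
    intro i f hf
    obtain ⟨u, hu, v, hv, rfl⟩ := mem_span_pair_mul.1 hf
    exact add_mem hu.1 hv.2.1
  have hQ2 : ∀ i, Q i ≤ L ^ (i - c) := fun i t ht => ht.2.2
  have hmonoG : ∀ i, L ^ (i + 1 + 1) * C ≤ L ^ (i + 1) * C := fun i =>
    Ideal.mul_mono_left (Ideal.pow_le_pow_right (by omega))
  have hmonoL : ∀ i, L ^ (i + 1 - c) ≤ L ^ (i - c) := fun i =>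
    Ideal.pow_le_pow_right (by omega)
  have hQ3 : ∀ i, Q (i + 1) ≤ Q i := fun i h hh =>
    ⟨hmonoG i hh.1, hmonoG i hh.2.1, hmonoL i hh.2.2⟩
  have hQ4 : ∀ i, Ideal.span {a, b} * Q i ≤ Q (i + 1) := by
    intro i f hf
    have h1 := hQ1 i hf
    have h2 : f ∈ Ideal.span {a, b} * L ^ (i - c) := Ideal.mul_mono_right (hQ2 i) hf
    exact ⟨mul_memG ha _ _ h1, mul_memG hb _ _ h1, hstep i h2⟩
  let F : (Ideal.span {a, b} : Ideal R).Filtration R :=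
    { N := Q
      mono := hQ3
      smul_le := hQ4 }
  have hle : F ≤ F' := hQ2
  obtain ⟨n₀, hn₀⟩ := hF'.of_le hle
  refine ⟨n₀ + c + 1, fun n hn h h1 h2 => ?_⟩
  have hle2 : L ^ (n + 1) * C ≤ L ^ (n + 1) := Ideal.mul_le_left
  have h3 := hAR n (by omega) h (hle2 h1)
  have hm : h ∈ Q n := ⟨h1, h2, h3⟩
  obtain ⟨m, rfl⟩ : ∃ m, n = m + 1 := ⟨n - 1, by omega⟩
  have e : Ideal.span {a, b} * Q m = Q (m + 1) := hn₀ m (by omega)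
  rw [← e] at hm
  exact hQ1 m hm

theorem colon_pow {a b : R} {L C : Ideal R} (ha : a ∈ L) (_hb : b ∈ L) {K : ℕ}
    (hK : ∀ n ≥ K, ∀ h : R, a * h ∈ L ^ (n + 1) * C → b * h ∈ L ^ (n + 1) * C →
      h ∈ L ^ n * C) (i : ℕ) :
    ∀ n ≥ K, ∀ h : R, a ^ i * h ∈ L ^ (n + i) * C → b * h ∈ L ^ (n + 1) * C →
      h ∈ L ^ n * C := by
  induction i with
  | zero => intro n _ h h1 _; simpa using h1
  | succ i ih =>
    intro n hn h h1 h2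
    refine hK n hn h (ih (n + 1) (by omega) (a * h) ?_ ?_) h2
    · rw [show n + 1 + i = n + (i + 1) by ring, ← mul_assoc, ← pow_succ]; exact h1
    · rw [mul_left_comm]; exact mul_memG ha _ _ h2

theorem surj_aux {a b : R} {L C : Ideal R} (ha : a ∈ L) (hb : b ∈ L)
    {N : ℕ} (hN : ∀ n ≥ N, Ideal.span {a, b} * L ^ n = L ^ (n + 1))
    (n : ℕ) (hn : N ≤ n) (j : ℕ) :
    ∀ f ∈ L ^ (n + j + 2) * C, ∃ u ∈ L ^ n * C, ∃ v ∈ L ^ n * C, ∃ g ∈ L ^ (n + j) * C,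
      f = a ^ (j + 2) * u + b ^ (j + 2) * v + a * b * g := by
  have split : ∀ m ≥ N, ∀ f ∈ L ^ (m + 1) * C,
      ∃ u ∈ L ^ m * C, ∃ v ∈ L ^ m * C, f = a * u + b * v := by
    intro m hm f hf
    rw [← hN m hm, mul_assoc] at hf
    exact mem_span_pair_mul.1 hf
  induction j with
  | zero =>
    intro f hf
    obtain ⟨f1, h1, f2, h2, rfl⟩ := split (n + 1) (by omega) f hf
    obtain ⟨u1, hu1, v1, hv1, rfl⟩ := split n hn f1 h1
    obtain ⟨u2, hu2, v2, hv2, rfl⟩ := split n hn f2 h2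
    exact ⟨u1, hu1, v2, hv2, v1 + u2, add_mem hv1 hu2, by ring⟩
  | succ j ih =>
    intro f hf
    obtain ⟨f1, h1, f2, h2, rfl⟩ := split (n + j + 2) (by omega) f hf
    obtain ⟨u1, hu1, v1, hv1, g1, hg1, rfl⟩ := ih f1 h1
    obtain ⟨u2, hu2, v2, hv2, g2, hg2, rfl⟩ := ih f2 h2
    refine ⟨u1, hu1, v2, hv2, (b ^ (j + 1) * v1 + a * g1) + (a ^ (j + 1) * u2 + b * g2),
      add_mem (add_mem ?_ ?_) (add_mem ?_ ?_), by ring⟩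
    · exact pow_mul_memG hb _ _ _ hv1
    · exact mul_memG ha _ _ hg1
    · exact pow_mul_memG ha _ _ _ hu2
    · exact mul_memG hb _ _ hg2

end Helpers

/-- Let `(R, m)` be a 2-dimensional Cohen–Macaulay local ring with infinite residue field,
`I, J` `m`-primary ideals, `(x, y; z, w)` a complete reduction of `(I, J)`, and fix
`r, s ≥ 0`.  Then for all sufficiently large `k`, the multiplication-by-`xzyw` map
`I^{2k+r}J^{2k+s}/((xz)^k,(yw)^k)I^{k+r}J^{k+s} →
 I^{2k+r+2}J^{2k+s+2}/((xz)^{k+1},(yw)^{k+1})I^{k+r+1}J^{k+s+1}`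
is an isomorphism (stated elementwise: surjectivity as the first inclusion, injectivity as the
second implication). -/
theorem mul_xzyw_bijective_of_large_k {R : Type*} [CommRing R]
    [IsNoetherianRing R] [IsLocalRing R] [Infinite (ResidueField R)]
    (hdim : ringKrullDim R = 2)
    (hCM : ∃ a b : R, a ∈ maximalIdeal R ∧ b ∈ maximalIdeal R ∧
      RingTheory.Sequence.IsRegular R [a, b])
    (I J : Ideal R) (hI : I.radical = maximalIdeal R) (hJ : J.radical = maximalIdeal R)
    (x y z w : R) (hx : x ∈ I) (hy : y ∈ I) (hz : z ∈ J) (hw : w ∈ J)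
    (hcr : ∃ N : ℕ, ∀ n ≥ N,
      Ideal.span {x * z, y * w} * (I * J) ^ n = (I * J) ^ (n + 1))
    (r s : ℕ) :
    ∃ K : ℕ, ∀ k ≥ K,
      -- surjectivity of multiplication by `xzyw`:
      (I ^ (2 * (k + 1) + r) * J ^ (2 * (k + 1) + s) ≤
        Ideal.span {x * z * y * w} * (I ^ (2 * k + r) * J ^ (2 * k + s)) +
          Ideal.span {(x * z) ^ (k + 1), (y * w) ^ (k + 1)} *
            (I ^ (k + 1 + r) * J ^ (k + 1 + s))) ∧
      -- injectivity of multiplication by `xzyw`: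
      (∀ d ∈ I ^ (2 * k + r) * J ^ (2 * k + s),
        x * z * y * w * d ∈
          Ideal.span {(x * z) ^ (k + 1), (y * w) ^ (k + 1)} *
            (I ^ (k + 1 + r) * J ^ (k + 1 + s)) →
        d ∈ Ideal.span {(x * z) ^ k, (y * w) ^ k} * (I ^ (k + r) * J ^ (k + s))) := by
  obtain ⟨α, β, hα, hβ, hreg⟩ := hCM
  obtain ⟨N, hN⟩ := hcr
  obtain ⟨h1, h2⟩ := regular_pair_elem hreg
  set a := x * z with ha
  set b := y * w with hb
  have haL : a ∈ I * J := Ideal.mul_mem_mul hx hz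
  have hbL : b ∈ I * J := Ideal.mul_mem_mul hy hw
  have hLm : I * J ≤ maximalIdeal R :=
    Ideal.mul_le_left.trans (hI ▸ Ideal.le_radical)
  have hrad : ∀ t ∈ maximalIdeal R, ∃ n, t ^ n ∈ Ideal.span {a, b} := by
    intro t ht
    obtain ⟨p, hp⟩ : t ∈ I.radical := hI ▸ ht
    obtain ⟨q, hq⟩ : t ∈ J.radical := hJ ▸ ht
    have h := Ideal.pow_mem_pow (Ideal.mul_mem_mul hp hq) (N + 1)
    rw [← hN N le_rfl, ← pow_add, ← pow_mul] at h
    have hle : Ideal.span {a, b} * (I * J) ^ N ≤ Ideal.span {a, b} := Ideal.mul_le_left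
    exact ⟨(p + q) * (N + 1), hle h⟩
  obtain ⟨p, hp⟩ := hrad α hα
  obtain ⟨q, hq⟩ := hrad β hβ
  have hab := koszul_of_regular (pow_regular h1 p)
    (fun t s h => pow_quot_regular h1 h2 p q t s h) hp hq
  have hba : ∀ u v, b * u + a * v = 0 → ∃ t, u = t * a ∧ v = -(t * b) := by
    intro u v h
    obtain ⟨t, e1, e2⟩ := hab v u (by linear_combination h)
    exact ⟨-t, by rw [e2]; ring, by rw [e1]; ring⟩
  have hna := nzd_of_koszul hab (hLm hbL)
  have hnb := nzd_of_koszul hba (hLm haL)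
  set C := I ^ r * J ^ s with hC
  have hG : ∀ n, I ^ (n + r) * J ^ (n + s) = (I * J) ^ n * C := by
    intro n; rw [hC, pow_add, pow_add, mul_pow]; ring
  obtain ⟨K, hK⟩ := ratliff_rush (C := C) haL hbL hN hna
  have hK1 := colon_pow (C := C) haL hbL hK
  have hK2 := colon_pow (C := C) hbL haL (fun n hn h e1 e2 => hK n hn h e2 e1)
  refine ⟨max K N, fun k hk => ?_⟩
  have hkK : K ≤ k := le_trans (le_max_left _ _) hk
  have hkN : N ≤ k := le_trans (le_max_right _ _) hk
  rw [hG, hG, hG, hG, show x * z * y * w = a * b by rw [ha, hb]; ring]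
  have mulG : ∀ {c : R}, c ∈ I * J → ∀ (j n : ℕ) (f : R), f ∈ (I * J) ^ n * C →
      c ^ j * f ∈ (I * J) ^ (n + j) * C := fun hc j n f hf => pow_mul_memG hc j n f hf
  constructor
  · intro f hf
    rw [show 2 * (k + 1) = k + k + 2 by ring] at hf
    obtain ⟨u, hu, v, hv, g, hg, rfl⟩ := surj_aux haL hbL hN k hkN k f hf
    rw [show k + k = 2 * k by ring] at hg
    have hu' := mulG haL 1 k u hu
    have hv' := mulG hbL 1 k v hv
    rw [pow_one] at hu' hv'
    rw [Submodule.add_eq_sup]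
    refine Submodule.mem_sup.2 ⟨a * b * g, Ideal.mul_mem_mul (Ideal.mem_span_singleton_self _) hg,
      a ^ (k + 1) * (a * u) + b ^ (k + 1) * (b * v), ?_, by ring⟩
    exact mem_span_pair_mul.2 ⟨_, hu', _, hv', rfl⟩
  · intro d hd hmem
    obtain ⟨u, hu, v, hv, e⟩ := mem_span_pair_mul.1 hmem
    obtain ⟨u', rfl⟩ := div_of_koszul hab (k + 1) u (a * d - b ^ k * v)
      (by linear_combination -e)
    obtain ⟨v', rfl⟩ := div_of_koszul hba (k + 1) v (b * d - a ^ k * (b * u'))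
      (by linear_combination -e)
    have e1 : d = a ^ k * u' + b ^ k * v' := by
      have : a * (b * (d - (a ^ k * u' + b ^ k * v'))) = 0 := by linear_combination e
      exact sub_eq_zero.1 (hnb _ (hna _ this))
    have ad := mulG haL 1 _ d hd
    have bd := mulG hbL 1 _ d hd
    have bv := mulG hbL k _ _ hv
    have au := mulG haL k _ _ hu
    rw [pow_one] at ad bd
    rw [show k + 1 + k = 2 * k + 1 by ring] at bv au
    have f1 : u' ∈ (I * J) ^ k * C := by
      refine hK1 (k + 1) k hkK u' ?_ hu
      rw [show k + (k + 1) = 2 * k + 1 by ring]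
      convert! sub_mem ad bv using 1
      rw [e1]; ring
    have f2 : v' ∈ (I * J) ^ k * C := by
      refine hK2 (k + 1) k hkK v' ?_ hv
      rw [show k + (k + 1) = 2 * k + 1 by ring]
      convert! sub_mem bd au using 1
      rw [e1]; ring
    exact mem_span_pair_mul.2 ⟨u', f1, v', f2, e1⟩
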